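/- Every triangular automorphism T of B commutes with D, i.e., T∘D = D∘T. -/

import Mathlib

noncomputable section

/-- The ideal `(XⁿY - φ(Z))` of `K[X,Y,Z]`. -/
def danIdealN (K : Type*) [Field K] (n : ℕ) (φ : Polynomial K) :
    Ideal (MvPolynomial (Fin 3) K) :=
  Ideal.span
    {MvPolynomial.X 0 ^ n * MvPolynomial.X 1 - Polynomial.aeval (MvPolynomial.X 2) φ}

/-- The Danielewski surface `B = K[X,Y,Z]/(XⁿY - φ(Z))`. -/
def DanSurfN (K : Type*) [Field K] (n : ℕ) (φ : Polynomial K) : Type _ :=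
  MvPolynomial (Fin 3) K ⧸ danIdealN K n φ

instance (K : Type*) [Field K] (n : ℕ) (φ : Polynomial K) : CommRing (DanSurfN K n φ) :=
  Ideal.Quotient.commRing _

instance (K : Type*) [Field K] (n : ℕ) (φ : Polynomial K) : Algebra K (DanSurfN K n φ) :=
  Ideal.Quotient.algebra _

/-- The image `x` of `X` in `B`. -/
def nx (K : Type*) [Field K] (n : ℕ) (φ : Polynomial K) : DanSurfN K n φ :=
  Ideal.Quotient.mk (danIdealN K n φ) (MvPolynomial.X 0)

/-- The image `y` of `Y` in `B`. -/
def ny (K : Type*) [Field K] (n : ℕ) (φ : Polynomial K) : DanSurfN K n φ :=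
  Ideal.Quotient.mk (danIdealN K n φ) (MvPolynomial.X 1)

/-- The image `z` of `Z` in `B`. -/
def nz (K : Type*) [Field K] (n : ℕ) (φ : Polynomial K) : DanSurfN K n φ :=
  Ideal.Quotient.mk (danIdealN K n φ) (MvPolynomial.X 2)

theorem X_zero_not_dvd_danRelation {K : Type*} [Field K] {n : ℕ} {φ : Polynomial K}
    (hφ : φ ≠ 0) :
    ¬ (MvPolynomial.X 0 : MvPolynomial (Fin 3) K) ∣
      MvPolynomial.X 0 ^ n * MvPolynomial.X 1 - Polynomial.aeval (MvPolynomial.X 2) φ := by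
  rintro ⟨c, hc⟩
  have key := congrArg
    (MvPolynomial.aeval (![0, 0, Polynomial.X] : Fin 3 → Polynomial K)) hc
  simp [← Polynomial.aeval_algHom_apply] at key
  exact hφ key

theorem isLeftRegular_nx {K : Type*} [Field K] {n : ℕ} {φ : Polynomial K}
    (hφ : φ ≠ 0) : IsLeftRegular (nx K n φ) := by
  rw [isLeftRegular_iff_right_eq_zero_of_mul]
  intro b hb
  obtain ⟨p, rfl⟩ := Ideal.Quotient.mk_surjective (I := danIdealN K n φ) b
  have hb' : Ideal.Quotient.mk (danIdealN K n φ) (MvPolynomial.X 0 * p) = 0 := by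
    rw [map_mul]
    exact hb
  rw [Ideal.Quotient.eq_zero_iff_mem, danIdealN, Ideal.mem_span_singleton] at hb'
  obtain ⟨c, hc⟩ := hb'
  have hX : Prime (MvPolynomial.X 0 : MvPolynomial (Fin 3) K) := MvPolynomial.X_prime
  obtain ⟨d, rfl⟩ := (hX.dvd_or_dvd (Dvd.intro _ hc)).resolve_left
    (X_zero_not_dvd_danRelation hφ)
  refine Ideal.Quotient.eq_zero_iff_mem.mpr ?_
  rw [danIdealN, Ideal.mem_span_singleton]
  exact ⟨d, mul_left_cancel₀ hX.ne_zero (by rw [hc]; ring)⟩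

theorem DanSurfN.induction_on {K : Type*} [Field K] {n : ℕ} {φ : Polynomial K}
    {P : DanSurfN K n φ → Prop} (b : DanSurfN K n φ)
    (algebraMap : ∀ a : K, P (algebraMap K _ a)) (add : ∀ a b, P a → P b → P (a + b))
    (mul : ∀ a b, P a → P b → P (a * b))
    (x : P (nx K n φ)) (y : P (ny K n φ)) (z : P (nz K n φ)) : P b := by
  obtain ⟨p, rfl⟩ := Ideal.Quotient.mk_surjective (I := danIdealN K n φ) b
  induction p using MvPolynomial.induction_on with
  | C a => exact algebraMap a
  | add p q hp hq =>
    rw [map_add]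
    exact add _ _ hp hq
  | mul_X p i hp =>
    rw [map_mul]
    refine mul _ _ hp ?_
    fin_cases i
    exacts [x, y, z]

/-- Every triangular automorphism `T` of `B = K[X,Y,Z]/(XⁿY - φ(Z))`
(`T(x) = x`, `T(z) = z + xⁿ·h(x)`, `xⁿ·T(y) = φ(T(z))` for some `h ∈ K[X]`) commutes
with the locally nilpotent derivation `D` given by `D(x) = 0`, `D(y) = g(x)·φ'(z)`,
`D(z) = g(x)·xⁿ`. -/
theorem triangular_commutes_xn {K : Type*} [Field K] [IsAlgClosed K] [CharZero K]
    (n : ℕ) (hn : 1 < n) (φ : Polynomial K) (hφ : 1 < φ.natDegree)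
    (g : Polynomial K) (hg : g ≠ 0)
    (D : Derivation K (DanSurfN K n φ) (DanSurfN K n φ))
    (hDx : D (nx K n φ) = 0)
    (hDy : D (ny K n φ) =
      Polynomial.aeval (nx K n φ) g * Polynomial.aeval (nz K n φ) (Polynomial.derivative φ))
    (hDz : D (nz K n φ) = Polynomial.aeval (nx K n φ) g * nx K n φ ^ n)
    (T : DanSurfN K n φ ≃ₐ[K] DanSurfN K n φ) (h : Polynomial K)
    (hTx : T (nx K n φ) = nx K n φ)
    (hTz : T (nz K n φ) = nz K n φ + nx K n φ ^ n * Polynomial.aeval (nx K n φ) h)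
    (hTy : nx K n φ ^ n * T (ny K n φ) = Polynomial.aeval (T (nz K n φ)) φ) :
    ∀ b, T (D b) = D (T b) := by
  have hφ0 : φ ≠ 0 := by
    rintro rfl
    simp at hφ
  have hDp (p : Polynomial K) : D (Polynomial.aeval (nx K n φ) p) = 0 := by
    rw [Derivation.map_aeval, hDx, smul_zero]
  have hTp (p : Polynomial K) :
      T (Polynomial.aeval (nx K n φ) p) = Polynomial.aeval (nx K n φ) p := by
    rw [← Polynomial.aeval_algHom_apply, hTx]
  have hDxn : D (nx K n φ ^ n) = 0 := by
    rw [Derivation.leibniz_pow, hDx, smul_zero, smul_zero]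
  have hDTz : D (T (nz K n φ)) = Polynomial.aeval (nx K n φ) g * nx K n φ ^ n := by
    rw [hTz, map_add, Derivation.leibniz, hDp, hDxn, hDz, smul_zero, smul_zero, add_zero, add_zero]
  intro b
  induction b using DanSurfN.induction_on with
  | algebraMap a => simp
  | add a b ha hb => simp only [map_add, ha, hb]
  | mul a b ha hb => simp only [Derivation.leibniz, map_add, map_mul, smul_eq_mul, ha, hb]
  | x => rw [hDx, hTx, hDx, map_zero]
  | z => rw [hDTz, hDz, map_mul, map_pow, hTx, hTp]
  | y =>
    apply (isLeftRegular_nx hφ0).pow n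
    have key := congrArg D hTy
    rw [Derivation.leibniz, hDxn, smul_zero, add_zero, Derivation.map_aeval, hDTz,
      smul_eq_mul, smul_eq_mul] at key
    have hTφ : T (Polynomial.aeval (nz K n φ) (Polynomial.derivative φ)) =
        Polynomial.aeval (T (nz K n φ)) (Polynomial.derivative φ) :=
      (Polynomial.aeval_algHom_apply T _ _).symm
    change nx K n φ ^ n * T (D (ny K n φ)) = nx K n φ ^ n * D (T (ny K n φ))
    rw [key, hDy, map_mul, hTp, hTφ]
    ring
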